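/- Let X be a coloured random graph with n vertices, colour law μ : 𝒳 → (0,1], and connection probabilities p_n satisfying (n·log n)·p_n(a,b) → C(a,b) for all a,b ∈ 𝒳, for some symmetric C : 𝒳×𝒳 → [0,∞). Then for every ε > 0, lim_{n→∞} ℙ_n{ | −(1/n)·log P_n(X) − (1/2)·Σ_{a,b∈𝒳} μ(a)·C(a,b)·μ(b) + Σ_{a∈𝒳} μ(a)·log μ(a) | ≥ ε } = 0. -/

import Mathlib

open Filter
open scoped ENNReal

noncomputable section

namespace CRG

variable {𝒳 : Type} [Fintype 𝒳] [DecidableEq 𝒳]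

/-- The set `ℰ` of formally ordered potential edges on `{1,…,n}`. -/
abbrev Edges (n : ℕ) : Finset (Fin n × Fin n) :=
  Finset.univ.filter (fun e : Fin n × Fin n => e.1 < e.2)

/-- The probability weight `P_n(x)` of a coloured graph `x` (colouring, edge set) under the
coloured random graph law with colour law `μ` and connection probabilities `p`. -/
def graphWeight (μ : 𝒳 → ℝ) (p : 𝒳 → 𝒳 → ℝ) (n : ℕ)
    (x : (Fin n → 𝒳) × Finset (Fin n × Fin n)) : ℝ :=
  (if x.2 ⊆ Edges n then 1 else 0) *
  (∏ v, μ (x.1 v)) *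
  ∏ e ∈ Edges n, (if e ∈ x.2 then p (x.1 e.1) (x.1 e.2) else 1 - p (x.1 e.1) (x.1 e.2))

/-- The probability `ℙ_n(S)` of an event `S` under the coloured random graph law. -/
def graphPr (μ : 𝒳 → ℝ) (p : 𝒳 → 𝒳 → ℝ) (n : ℕ)
    (S : Set ((Fin n → 𝒳) × Finset (Fin n × Fin n))) : ℝ :=
  ∑ x, S.indicator (graphWeight μ p n) x

/-- The empirical colour measure `L¹`. -/
def L1 (n : ℕ) (x : (Fin n → 𝒳) × Finset (Fin n × Fin n)) (a : 𝒳) : ℝ :=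
  ((Finset.univ.filter (fun v : Fin n => x.1 v = a)).card : ℝ) / n

/-- The empirical pair measure `L²` (scaled by `1/(n² aₙ)`). -/
def L2 (an : ℝ) (n : ℕ) (x : (Fin n → 𝒳) × Finset (Fin n × Fin n)) (q : 𝒳 × 𝒳) : ℝ :=
  (∑ e ∈ x.2, ((if (x.1 e.1, x.1 e.2) = q then (1:ℝ) else 0)
    + (if (x.1 e.2, x.1 e.1) = q then (1:ℝ) else 0))) / ((n:ℝ)^2 * an)

/-- Extended-real logarithm, `log 0 = -∞`. -/
def elog (x : ℝ) : EReal := if x ≤ 0 then ⊥ else ((Real.log x : ℝ) : EReal)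

/-- `ℳ(𝒳) × ℳ̃_*(𝒳×𝒳)`: probability vectors paired with finite symmetric measures,
viewed inside `ℝ^𝒳 × ℝ^(𝒳×𝒳)`. -/
def MSpace (𝒳 : Type) [Fintype 𝒳] : Set ((𝒳 → ℝ) × (𝒳 × 𝒳 → ℝ)) :=
  {z | (∀ a, 0 ≤ z.1 a) ∧ (∑ a, z.1 a) = 1 ∧ (∀ q, 0 ≤ z.2 q) ∧ ∀ a b, z.2 (a,b) = z.2 (b,a)}

open Classical in
/-- Relative entropy `H(ν‖ρ)` of measures on a finite set, `+∞` if `ν` is not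
absolutely continuous w.r.t. `ρ`. -/
def relEnt (ν ρ : 𝒳 → ℝ) : ℝ≥0∞ :=
  if ∀ x, ρ x = 0 → ν x = 0 then
    ENNReal.ofReal (∑ x, ν x * Real.log (ν x / ρ x)) else ⊤

open Classical in
/-- `𝔥_C(ϖ‖ω) = H(ϖ‖Cω⊗ω) + ‖Cω⊗ω‖ − ‖ϖ‖`. -/
def hRel (C : 𝒳 → 𝒳 → ℝ) (ω : 𝒳 → ℝ) (ϖ : 𝒳 × 𝒳 → ℝ) : ℝ≥0∞ :=
  if ∀ q : 𝒳 × 𝒳, C q.1 q.2 * ω q.1 * ω q.2 = 0 → ϖ q = 0 then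
    ENNReal.ofReal ((∑ q : 𝒳 × 𝒳, ϖ q * Real.log (ϖ q / (C q.1 q.2 * ω q.1 * ω q.2)))
      + (∑ q : 𝒳 × 𝒳, C q.1 q.2 * ω q.1 * ω q.2) - ∑ q : 𝒳 × 𝒳, ϖ q)
  else ⊤

end CRG

open CRG

/-- Mean and second moment of a sum of independent centred two-valued variables. -/
lemma bernoulli_moments {α : Type*} [DecidableEq α] (S : Finset α) (q z₀ z₁ : α → ℝ)
    (hz : ∀ e, (1 - q e) * z₀ e + q e * z₁ e = 0) :
    ∑ t ∈ S.powerset, ∏ e ∈ S, (if e ∈ t then q e else 1 - q e) = 1 ∧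
    ∑ t ∈ S.powerset, (∏ e ∈ S, (if e ∈ t then q e else 1 - q e)) *
      ∑ e ∈ S, (if e ∈ t then z₁ e else z₀ e) = 0 ∧
    ∑ t ∈ S.powerset, (∏ e ∈ S, (if e ∈ t then q e else 1 - q e)) *
      (∑ e ∈ S, (if e ∈ t then z₁ e else z₀ e)) ^ 2 =
      ∑ e ∈ S, ((1 - q e) * z₀ e ^ 2 + q e * z₁ e ^ 2) := by
  induction S using Finset.induction_on with
  | empty => simp
  | insert a S ha ih =>
    obtain ⟨h1, h2, h3⟩ := ih
    have hout : ∀ t ∈ S.powerset, a ∉ t := fun t ht h => ha (Finset.mem_powerset.1 ht h)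
    have hW0 : ∀ t ∈ S.powerset, ∏ e ∈ insert a S, (if e ∈ t then q e else 1 - q e) =
        (1 - q a) * ∏ e ∈ S, (if e ∈ t then q e else 1 - q e) := fun t ht => by
      rw [Finset.prod_insert ha, if_neg (hout t ht)]
    have hZ0 : ∀ t ∈ S.powerset, ∑ e ∈ insert a S, (if e ∈ t then z₁ e else z₀ e) =
        z₀ a + ∑ e ∈ S, (if e ∈ t then z₁ e else z₀ e) := fun t ht => by
      rw [Finset.sum_insert ha, if_neg (hout t ht)]
    have hmem : ∀ t : Finset α, ∀ e ∈ S, (e ∈ insert a t ↔ e ∈ t) := fun t e he => by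
      have hne : e ≠ a := fun h => ha (h ▸ he)
      simp [hne]
    have hW1 : ∀ t ∈ S.powerset, ∏ e ∈ insert a S, (if e ∈ insert a t then q e else 1 - q e) =
        q a * ∏ e ∈ S, (if e ∈ t then q e else 1 - q e) := fun t _ => by
      rw [Finset.prod_insert ha, if_pos (Finset.mem_insert_self _ _)]
      congr 1
      exact Finset.prod_congr rfl fun e he => by simp only [hmem t e he]
    have hZ1 : ∀ t ∈ S.powerset, ∑ e ∈ insert a S, (if e ∈ insert a t then z₁ e else z₀ e) =
        z₁ a + ∑ e ∈ S, (if e ∈ t then z₁ e else z₀ e) := fun t _ => by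
      rw [Finset.sum_insert ha, if_pos (Finset.mem_insert_self _ _)]
      congr 1
      exact Finset.sum_congr rfl fun e he => by simp only [hmem t e he]
    have key (F : ℝ → ℝ) : ∑ t ∈ (insert a S).powerset,
        (∏ e ∈ insert a S, (if e ∈ t then q e else 1 - q e)) *
          F (∑ e ∈ insert a S, (if e ∈ t then z₁ e else z₀ e)) =
        ∑ t ∈ S.powerset, (∏ e ∈ S, (if e ∈ t then q e else 1 - q e)) *
          ((1 - q a) * F (z₀ a + ∑ e ∈ S, (if e ∈ t then z₁ e else z₀ e)) +
            q a * F (z₁ a + ∑ e ∈ S, (if e ∈ t then z₁ e else z₀ e))) := by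
      rw [Finset.sum_powerset_insert ha, ← Finset.sum_add_distrib]
      refine Finset.sum_congr rfl fun t ht => ?_
      rw [hW0 t ht, hZ0 t ht, hW1 t ht, hZ1 t ht]
      ring
    refine ⟨?_, ?_, ?_⟩
    · have := key (fun _ => 1)
      simpa [h1] using this
    · rw [key (fun x => x)]
      rw [← h2]
      refine Finset.sum_congr rfl fun t _ => ?_
      linear_combination (∏ e ∈ S, (if e ∈ t then q e else 1 - q e)) * hz a
    · have hv := congrArg (fun x => ((1 - q a) * z₀ a ^ 2 + q a * z₁ a ^ 2) * x) h1
      simp only [mul_one] at hv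
      rw [key (fun x => x ^ 2), Finset.sum_insert ha, ← h3, ← hv, Finset.mul_sum,
        ← Finset.sum_add_distrib]
      refine Finset.sum_congr rfl fun t _ => ?_
      linear_combination (2 * (∏ e ∈ S, (if e ∈ t then q e else 1 - q e)) *
        ∑ e ∈ S, (if e ∈ t then z₁ e else z₀ e)) * hz a

/-- Mean and second moment of a sum of i.i.d. centred variables over a finite alphabet. -/
lemma iid_moments {𝒳 : Type*} [Fintype 𝒳] (μ g : 𝒳 → ℝ) (hμ : ∑ a, μ a = 1)
    (hg : ∑ a, μ a * g a = 0) (n : ℕ) :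
    ∑ c : Fin n → 𝒳, ∏ v, μ (c v) = 1 ∧
    ∑ c : Fin n → 𝒳, (∏ v, μ (c v)) * ∑ v, g (c v) = 0 ∧
    ∑ c : Fin n → 𝒳, (∏ v, μ (c v)) * (∑ v, g (c v)) ^ 2 = n * ∑ a, μ a * g a ^ 2 := by
  induction n with
  | zero => simp
  | succ n ih =>
    obtain ⟨h1, h2, h3⟩ := ih
    have key (F : ℝ → ℝ) : ∑ c : Fin (n + 1) → 𝒳, (∏ v, μ (c v)) * F (∑ v, g (c v)) =
        ∑ a, ∑ c : Fin n → 𝒳, (μ a * ∏ v, μ (c v)) * F (g a + ∑ v, g (c v)) := by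
      rw [← (Fin.consEquiv fun _ => 𝒳).sum_comp, Fintype.sum_prod_type]
      simp [Fin.consEquiv, Fin.prod_univ_succ, Fin.sum_univ_succ]
    refine ⟨?_, ?_, ?_⟩
    · have := key (fun _ => 1)
      simpa only [mul_one, ← Finset.mul_sum, h1, hμ] using this
    · have : ∀ a, ∑ c : Fin n → 𝒳, (μ a * ∏ v, μ (c v)) * (g a + ∑ v, g (c v)) =
          μ a * g a := fun a => by
        calc _ = μ a * g a * ∑ c : Fin n → 𝒳, ∏ v, μ (c v) +
              μ a * ∑ c : Fin n → 𝒳, (∏ v, μ (c v)) * ∑ v, g (c v) := by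
              rw [Finset.mul_sum, Finset.mul_sum, ← Finset.sum_add_distrib]
              exact Finset.sum_congr rfl fun c _ => by ring
          _ = _ := by rw [h1, h2]; ring
      rw [key (fun x => x)]
      simp only [this, hg]
    · have : ∀ a, ∑ c : Fin n → 𝒳, (μ a * ∏ v, μ (c v)) * (g a + ∑ v, g (c v)) ^ 2 =
          μ a * g a ^ 2 + μ a * (n * ∑ a, μ a * g a ^ 2) := fun a => by
        calc _ = μ a * g a ^ 2 * ∑ c : Fin n → 𝒳, ∏ v, μ (c v) +
              2 * μ a * g a * ∑ c : Fin n → 𝒳, (∏ v, μ (c v)) * ∑ v, g (c v) +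
              μ a * ∑ c : Fin n → 𝒳, (∏ v, μ (c v)) * (∑ v, g (c v)) ^ 2 := by
              rw [Finset.mul_sum, Finset.mul_sum, Finset.mul_sum, ← Finset.sum_add_distrib,
                ← Finset.sum_add_distrib]
              exact Finset.sum_congr rfl fun c _ => by ring
          _ = _ := by rw [h1, h2, h3]; ring
      rw [key (fun x => x ^ 2)]
      simp only [this, Finset.sum_add_distrib, ← Finset.sum_mul, hμ]
      push_cast
      ring

lemma tendsto_zero_of_tendsto_mul_log {q : ℕ → ℝ} {c : ℝ}
    (h : Tendsto (fun n : ℕ => ((n : ℝ) * Real.log n) * q n) atTop (nhds c)) :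
    Tendsto (fun n : ℕ => (n : ℝ) * q n) atTop (nhds 0) ∧ Tendsto q atTop (nhds 0) := by
  have hlog : Tendsto (fun n : ℕ => Real.log n) atTop atTop :=
    Real.tendsto_log_atTop.comp tendsto_natCast_atTop_atTop
  have h1 : Tendsto (fun n : ℕ => (n : ℝ) * q n) atTop (nhds 0) := by
    refine (h.div_atTop hlog).congr' ?_
    filter_upwards [hlog.eventually_gt_atTop 0] with n hn
    field_simp
  refine ⟨h1, (h1.div_atTop tendsto_natCast_atTop_atTop).congr' ?_⟩
  filter_upwards [eventually_gt_atTop 0] with n hn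
  have : (n : ℝ) ≠ 0 := by positivity
  field_simp

/-- In the critical regime the rescaled edge entropy converges. -/
lemma tendsto_mul_binEntropy {q : ℕ → ℝ} {c : ℝ} (h0 : ∀ n, 0 ≤ q n) (hq1 : ∀ n, q n ≤ 1)
    (h : Tendsto (fun n : ℕ => ((n : ℝ) * Real.log n) * q n) atTop (nhds c)) :
    Tendsto (fun n : ℕ => (n : ℝ) * Real.binEntropy (q n)) atTop (nhds c) := by
  have hlog : Tendsto (fun n : ℕ => Real.log n) atTop atTop :=
    Real.tendsto_log_atTop.comp tendsto_natCast_atTop_atTop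
  have hnq := (tendsto_zero_of_tendsto_mul_log h).1
  have hB : Tendsto (fun n : ℕ => (n : ℝ) * ((1 - q n) * Real.log (1 - q n)⁻¹)) atTop
      (nhds 0) := by
    refine squeeze_zero (fun n => ?_) (fun n => ?_) hnq
    · refine mul_nonneg n.cast_nonneg (mul_nonneg (sub_nonneg.2 (hq1 n)) ?_)
      rw [Real.log_inv]
      exact neg_nonneg.2 (Real.log_nonpos (sub_nonneg.2 (hq1 n)) (by linarith [h0 n]))
    · refine mul_le_mul_of_nonneg_left ?_ n.cast_nonneg
      rcases (hq1 n).eq_or_lt with h' | h'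
      · simp [h']
      · have hp : 0 < 1 - q n := sub_pos.2 h'
        have := mul_le_mul_of_nonneg_left (Real.log_le_sub_one_of_pos (inv_pos.2 hp)) hp.le
        rw [mul_sub, mul_inv_cancel₀ hp.ne'] at this
        linarith
  have hll : Tendsto (fun n : ℕ => Real.log (Real.log n) / Real.log n) atTop (nhds 0) :=
    (Real.isLittleO_log_id_atTop.tendsto_div_nhds_zero).comp hlog
  have hA : Tendsto (fun n : ℕ => (n : ℝ) * (q n * Real.log (q n)⁻¹)) atTop (nhds c) := by
    have hcl := ((Real.continuous_mul_log.tendsto c).comp h).div_atTop hlog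
    have := (h.mul (hll.const_add 1)).sub hcl
    rw [add_zero, mul_one, sub_zero] at this
    refine this.congr' ?_
    filter_upwards [hlog.eventually_gt_atTop 0, eventually_gt_atTop 0] with n hn hn0
    have hn' : (0:ℝ) < n := by exact_mod_cast hn0
    rcases (h0 n).eq_or_lt with h' | h'
    · simp [← h']
    · simp only [Function.comp]
      rw [Real.log_mul (by positivity) h'.ne', Real.log_mul hn'.ne' hn.ne', Real.log_inv]
      field_simp
      ring
  have := hA.add hB
  rw [add_zero] at this
  refine this.congr fun n => ?_
  rw [Real.binEntropy]
  ring

/-- The second moment of the information content of a Bernoulli variable. -/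
def bernoulliInfoSq (q : ℝ) : ℝ := (1 - q) * Real.log (1 - q) ^ 2 + q * Real.log q ^ 2

lemma bernoulliInfoSq_nonneg {q : ℝ} (h0 : 0 ≤ q) (h1 : q ≤ 1) : 0 ≤ bernoulliInfoSq q :=
  add_nonneg (mul_nonneg (sub_nonneg.2 h1) (sq_nonneg _)) (mul_nonneg h0 (sq_nonneg _))

lemma tendsto_bernoulliInfoSq {q : ℕ → ℝ} (h0 : ∀ n, 0 ≤ q n)
    (h : Tendsto q atTop (nhds 0)) :
    Tendsto (fun n => bernoulliInfoSq (q n)) atTop (nhds 0) := by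
  have hA : Tendsto (fun n => (1 - q n) * Real.log (1 - q n) ^ 2) atTop (nhds 0) := by
    have h1 : Tendsto (fun n => 1 - q n) atTop (nhds 1) := by simpa using h.const_sub 1
    simpa using h1.mul ((h1.log one_ne_zero).pow 2)
  have hB : Tendsto (fun n => q n * Real.log (q n) ^ 2) atTop (nhds 0) := by
    have hs : Tendsto (fun n => √(q n)) atTop (nhds 0) := by simpa using h.sqrt
    have := (((Real.continuous_mul_log.tendsto 0).comp hs).pow 2).const_mul 4
    simp only [Real.log_zero, mul_zero, ne_eq, OfNat.ofNat_ne_zero, not_false_eq_true,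
      zero_pow] at this
    refine this.congr fun n => ?_
    simp only [Function.comp]
    rw [Real.log_sqrt (h0 n), mul_pow, Real.sq_sqrt (h0 n)]
    ring
  have := hA.add hB
  rw [add_zero] at this
  exact this

lemma sum_graphWeight_mul {𝒳 : Type} [Fintype 𝒳] (μ : 𝒳 → ℝ)
    (p : 𝒳 → 𝒳 → ℝ) (n : ℕ) (F : (Fin n → 𝒳) × Finset (Fin n × Fin n) → ℝ) :
    ∑ x, graphWeight μ p n x * F x = ∑ c : Fin n → 𝒳, (∏ v, μ (c v)) *
      ∑ t ∈ (Edges n).powerset, (∏ e ∈ Edges n,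
        (if e ∈ t then p (c e.1) (c e.2) else 1 - p (c e.1) (c e.2))) * F (c, t) := by
  rw [Fintype.sum_prod_type]
  refine Finset.sum_congr rfl fun c _ => ?_
  rw [Finset.mul_sum, ← Finset.sum_subset (Finset.subset_univ (Edges n).powerset)]
  · refine Finset.sum_congr rfl fun t ht => ?_
    rw [graphWeight, if_pos (Finset.mem_powerset.1 ht)]
    ring
  · intro t _ ht
    rw [graphWeight, if_neg (fun h => ht (Finset.mem_powerset.2 h))]
    ring

lemma graphWeight_nonneg {𝒳 : Type} {μ : 𝒳 → ℝ} {p : 𝒳 → 𝒳 → ℝ}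
    (hμ0 : ∀ a, 0 < μ a) (hp0 : ∀ a b, 0 ≤ p a b) (hp1 : ∀ a b, p a b ≤ 1) (n : ℕ)
    (x : (Fin n → 𝒳) × Finset (Fin n × Fin n)) : 0 ≤ graphWeight μ p n x := by
  rw [graphWeight]
  refine mul_nonneg (mul_nonneg (by split_ifs <;> simp)
    (Finset.prod_nonneg fun v _ => (hμ0 _).le)) (Finset.prod_nonneg fun e _ => ?_)
  split_ifs
  · exact hp0 _ _
  · exact sub_nonneg.2 (hp1 _ _)

/-- The centred information content carried by the edges. -/
def edgeFluct {𝒳 : Type} (p : 𝒳 → 𝒳 → ℝ) (n : ℕ)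
    (x : (Fin n → 𝒳) × Finset (Fin n × Fin n)) : ℝ :=
  ∑ e ∈ Edges n, (if e ∈ x.2
    then -Real.log (p (x.1 e.1) (x.1 e.2)) - Real.binEntropy (p (x.1 e.1) (x.1 e.2))
    else -Real.log (1 - p (x.1 e.1) (x.1 e.2)) - Real.binEntropy (p (x.1 e.1) (x.1 e.2)))

lemma sum_graphWeight_mul_edgeFluct_sq_le {𝒳 : Type} [Fintype 𝒳] {μ : 𝒳 → ℝ}
    (hμ0 : ∀ a, 0 < μ a) (hμs : ∑ a, μ a = 1) {p : 𝒳 → 𝒳 → ℝ}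
    (hp0 : ∀ a b, 0 ≤ p a b) (hp1 : ∀ a b, p a b ≤ 1) (n : ℕ) :
    ∑ x, graphWeight μ p n x * edgeFluct p n x ^ 2 ≤
      (n : ℝ) ^ 2 * ∑ q : 𝒳 × 𝒳, bernoulliInfoSq (p q.1 q.2) := by
  set V := ∑ q : 𝒳 × 𝒳, bernoulliInfoSq (p q.1 q.2) with hV
  have hV0 : 0 ≤ V := Finset.sum_nonneg fun q _ => bernoulliInfoSq_nonneg (hp0 _ _) (hp1 _ _)
  rw [sum_graphWeight_mul]
  have hinner : ∀ c : Fin n → 𝒳, ∑ t ∈ (Edges n).powerset, (∏ e ∈ Edges n,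
      (if e ∈ t then p (c e.1) (c e.2) else 1 - p (c e.1) (c e.2))) *
        edgeFluct p n (c, t) ^ 2 ≤ (n : ℝ) ^ 2 * V := by
    intro c
    have hm := (bernoulli_moments (Edges n) (fun e => p (c e.1) (c e.2))
      (fun e => -Real.log (1 - p (c e.1) (c e.2)) - Real.binEntropy (p (c e.1) (c e.2)))
      (fun e => -Real.log (p (c e.1) (c e.2)) - Real.binEntropy (p (c e.1) (c e.2)))
      (fun e => by simp only [Real.binEntropy, Real.log_inv]; ring)).2.2
    simp only [edgeFluct]
    rw [hm]
    calc _ ≤ ∑ _e ∈ Edges n, V := by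
          refine Finset.sum_le_sum fun e _ => ?_
          refine le_trans ?_ (Finset.single_le_sum
            (f := fun q : 𝒳 × 𝒳 => bernoulliInfoSq (p q.1 q.2))
            (fun q _ => bernoulliInfoSq_nonneg (hp0 _ _) (hp1 _ _))
            (Finset.mem_univ (c e.1, c e.2)))
          simp only [bernoulliInfoSq, Real.binEntropy, Real.log_inv]
          generalize p (c e.1) (c e.2) = q
          nlinarith [sq_nonneg (q * Real.log q + (1 - q) * Real.log (1 - q))]
      _ = (Edges n).card * V := by simp
      _ ≤ _ := by
          refine mul_le_mul_of_nonneg_right ?_ hV0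
          have : (Edges n).card ≤ n ^ 2 := by
            refine (Finset.card_le_univ _).trans ?_
            simp [sq]
          exact_mod_cast this
  have h1 := (iid_moments μ (fun _ => 0) hμs (by simp) n).1
  calc _ ≤ ∑ c : Fin n → 𝒳, (∏ v, μ (c v)) * ((n : ℝ) ^ 2 * V) :=
        Finset.sum_le_sum fun c _ => mul_le_mul_of_nonneg_left (hinner c)
          (Finset.prod_nonneg fun v _ => (hμ0 _).le)
    _ = _ := by rw [← Finset.sum_mul, h1, one_mul]

lemma sum_comp_eq_L1 {𝒳 : Type} [Fintype 𝒳] [DecidableEq 𝒳] {n : ℕ} (hn : 0 < n)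
    (x : (Fin n → 𝒳) × Finset (Fin n × Fin n)) (f : 𝒳 → ℝ) :
    ∑ v, f (x.1 v) = n * ∑ a, L1 n x a * f a := by
  have hn' : (n : ℝ) ≠ 0 := by positivity
  rw [← Finset.sum_fiberwise Finset.univ x.1, Finset.mul_sum]
  refine Finset.sum_congr rfl fun a _ => ?_
  rw [Finset.sum_congr rfl (g := fun _ => f a)
    (fun v hv => by rw [(Finset.mem_filter.1 hv).2])]
  simp only [Finset.sum_const, nsmul_eq_mul, L1]
  field_simp

lemma sum_graphWeight_mul_L1_sub_sq_le {𝒳 : Type} [Fintype 𝒳] [DecidableEq 𝒳] {μ : 𝒳 → ℝ}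
    (hμ0 : ∀ a, 0 < μ a) (hμ1 : ∀ a, μ a ≤ 1) (hμs : ∑ a, μ a = 1) (p : 𝒳 → 𝒳 → ℝ)
    {n : ℕ} (hn : 0 < n) (a : 𝒳) :
    ∑ x, graphWeight μ p n x * (L1 n x a - μ a) ^ 2 ≤ 1 / n := by
  have hn' : (0 : ℝ) < n := by exact_mod_cast hn
  rw [sum_graphWeight_mul]
  have hL : ∀ (c : Fin n → 𝒳) (t : Finset (Fin n × Fin n)), L1 n (c, t) a - μ a =
      (∑ v, ((if c v = a then 1 else 0) - μ a)) / n := by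
    intro c t
    simp only [L1, Finset.sum_sub_distrib, Finset.sum_boole, Finset.sum_const,
      Finset.card_univ, Fintype.card_fin, nsmul_eq_mul]
    field_simp
  have hW : ∀ c : Fin n → 𝒳, ∑ t ∈ (Edges n).powerset, ∏ e ∈ Edges n,
      (if e ∈ t then p (c e.1) (c e.2) else 1 - p (c e.1) (c e.2)) = 1 := fun c =>
    (bernoulli_moments (Edges n) (fun e => p (c e.1) (c e.2)) (fun _ => 0) (fun _ => 0)
      (by simp)).1
  simp only [hL, ← Finset.sum_mul, hW, one_mul]
  have hm := (iid_moments μ (fun j => (if j = a then 1 else 0) - μ a) hμs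
    (by simp [mul_sub, ← Finset.sum_mul, hμs]) n).2.2
  simp only [div_pow, mul_div_assoc', ← Finset.sum_div]
  rw [hm, div_le_div_iff₀ (by positivity) hn']
  have hle : ∑ j, μ j * ((if j = a then 1 else 0) - μ a) ^ 2 ≤ 1 := by
    rw [← hμs]
    refine Finset.sum_le_sum fun j _ => mul_le_of_le_one_right (hμ0 j).le ?_
    have := hμ0 a
    have := hμ1 a
    split_ifs <;> nlinarith
  nlinarith [mul_le_mul_of_nonneg_left hle (sq_nonneg (n : ℝ))]

lemma sum_Edges_of_symm {𝒳 : Type} [Fintype 𝒳] [DecidableEq 𝒳] {n : ℕ} (hn : 0 < n)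
    (x : (Fin n → 𝒳) × Finset (Fin n × Fin n)) (m : 𝒳 → 𝒳 → ℝ) (hm : ∀ a b, m a b = m b a) :
    ∑ e ∈ Edges n, m (x.1 e.1) (x.1 e.2) =
      (1 / 2) * ((n : ℝ) ^ 2 * ∑ q : 𝒳 × 𝒳, L1 n x q.1 * L1 n x q.2 * m q.1 q.2 -
        n * ∑ a, L1 n x a * m a a) := by
  have hall : ∑ e : Fin n × Fin n, m (x.1 e.1) (x.1 e.2) =
      (n : ℝ) ^ 2 * ∑ q : 𝒳 × 𝒳, L1 n x q.1 * L1 n x q.2 * m q.1 q.2 := by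
    simp only [Fintype.sum_prod_type]
    have : ∀ u, ∑ v, m (x.1 u) (x.1 v) = n * ∑ b, L1 n x b * m (x.1 u) b := fun u =>
      sum_comp_eq_L1 hn x _
    simp only [this]
    rw [sum_comp_eq_L1 hn x (fun a => n * ∑ b, L1 n x b * m a b)]
    simp only [Finset.mul_sum]
    exact Finset.sum_congr rfl fun a _ => Finset.sum_congr rfl fun b _ => by ring
  have hdiag := sum_comp_eq_L1 hn x (fun a => m a a)
  have hsplit : ∑ e : Fin n × Fin n, m (x.1 e.1) (x.1 e.2) =
      2 * ∑ e ∈ Edges n, m (x.1 e.1) (x.1 e.2) + ∑ v, m (x.1 v) (x.1 v) := by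
    have hswap : ∑ e ∈ Edges n, m (x.1 e.1) (x.1 e.2) =
        ∑ e : Fin n × Fin n, if e.2 < e.1 then m (x.1 e.1) (x.1 e.2) else 0 := by
      rw [Finset.sum_filter, ← (Equiv.prodComm (Fin n) (Fin n)).sum_comp]
      exact Finset.sum_congr rfl fun e _ => by simp [hm (x.1 e.2)]
    have hd : ∑ v, m (x.1 v) (x.1 v) =
        ∑ e : Fin n × Fin n, if e.1 = e.2 then m (x.1 e.1) (x.1 e.2) else 0 := by
      rw [Fintype.sum_prod_type]
      simp
    rw [two_mul]
    nth_rewrite 2 [hswap]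
    rw [hd, Finset.sum_filter, ← Finset.sum_add_distrib, ← Finset.sum_add_distrib]
    refine Finset.sum_congr rfl fun e _ => ?_
    rcases lt_trichotomy e.1 e.2 with h | h | h
    · simp [h, h.not_gt, h.ne]
    · simp [h]
    · simp [h, h.not_gt, h.ne']
  linarith

lemma L1_nonneg {𝒳 : Type} [Fintype 𝒳] [DecidableEq 𝒳] (n : ℕ)
    (x : (Fin n → 𝒳) × Finset (Fin n × Fin n)) (a : 𝒳) : 0 ≤ L1 n x a := by
  rw [L1]; positivity

lemma L1_le_one {𝒳 : Type} [Fintype 𝒳] [DecidableEq 𝒳] (n : ℕ)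
    (x : (Fin n → 𝒳) × Finset (Fin n × Fin n)) (a : 𝒳) : L1 n x a ≤ 1 := by
  rw [L1]
  refine div_le_one_of_le₀ ?_ n.cast_nonneg
  have := Finset.card_le_univ (Finset.univ.filter fun v : Fin n => x.1 v = a)
  rw [Fintype.card_fin] at this
  exact_mod_cast this

lemma neg_log_graphWeight {𝒳 : Type} {μ : 𝒳 → ℝ}
    (hμ0 : ∀ a, 0 < μ a) (p : 𝒳 → 𝒳 → ℝ) (n : ℕ)
    (x : (Fin n → 𝒳) × Finset (Fin n × Fin n)) (hx : graphWeight μ p n x ≠ 0) :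
    -Real.log (graphWeight μ p n x) = -∑ v, Real.log (μ (x.1 v)) + edgeFluct p n x +
      ∑ e ∈ Edges n, Real.binEntropy (p (x.1 e.1) (x.1 e.2)) := by
  rw [graphWeight] at hx
  have hE := right_ne_zero_of_mul hx
  have hS : x.2 ⊆ Edges n := by
    by_contra h
    simp [h] at hx
  rw [graphWeight, if_pos hS, one_mul,
    Real.log_mul (Finset.prod_ne_zero_iff.2 fun v _ => (hμ0 _).ne') hE,
    Real.log_prod (fun v _ => (hμ0 _).ne'), Real.log_prod (Finset.prod_ne_zero_iff.1 hE), neg_add,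
    add_assoc, edgeFluct, ← Finset.sum_add_distrib]
  congr 1
  rw [← Finset.sum_neg_distrib]
  refine Finset.sum_congr rfl fun e _ => ?_
  split_ifs <;> ring

/-- Deterministic control of the deviation of the information content per vertex. -/
lemma abs_info_sub_le {𝒳 : Type} [Fintype 𝒳] [DecidableEq 𝒳] {μ : 𝒳 → ℝ}
    (hμ0 : ∀ a, 0 < μ a) (hμ1 : ∀ a, μ a ≤ 1) {p : 𝒳 → 𝒳 → ℝ}
    (hp0 : ∀ a b, 0 ≤ p a b) (hp1 : ∀ a b, p a b ≤ 1) (hpsymm : ∀ a b, p a b = p b a)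
    {C : 𝒳 → 𝒳 → ℝ} (hC0 : ∀ a b, 0 ≤ C a b) {n : ℕ} (hn : 0 < n)
    (x : (Fin n → 𝒳) × Finset (Fin n × Fin n)) (hx : graphWeight μ p n x ≠ 0) :
    |(-(1/(n:ℝ)) * Real.log (graphWeight μ p n x))
            - (1/2) * ∑ q : 𝒳 × 𝒳, μ q.1 * C q.1 q.2 * μ q.2
            + ∑ i, μ i * Real.log (μ i)| ≤
      |edgeFluct p n x| / n +
      (∑ a, |Real.log (μ a)| + ∑ q : 𝒳 × 𝒳, C q.1 q.2) * ∑ a, |L1 n x a - μ a| +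
      (∑ q : 𝒳 × 𝒳, |(n : ℝ) * Real.binEntropy (p q.1 q.2) - C q.1 q.2| +
        ∑ a, Real.binEntropy (p a a)) := by
  have hn' : (0 : ℝ) < n := by exact_mod_cast hn
  set Δ := ∑ a, |L1 n x a - μ a| with hΔ
  have hΔle : ∀ a, |L1 n x a - μ a| ≤ Δ := fun a =>
    Finset.single_le_sum (f := fun a => |L1 n x a - μ a|) (fun _ _ => abs_nonneg _)
      (Finset.mem_univ a)
  have hent : ∀ a b, 0 ≤ Real.binEntropy (p a b) := fun a b =>
    Real.binEntropy_nonneg (hp0 a b) (hp1 a b)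
  have hdec : (-(1/(n:ℝ)) * Real.log (graphWeight μ p n x))
            - (1/2) * ∑ q : 𝒳 × 𝒳, μ q.1 * C q.1 q.2 * μ q.2
            + ∑ i, μ i * Real.log (μ i) =
      edgeFluct p n x / n - ∑ a, (L1 n x a - μ a) * Real.log (μ a) +
      (1 / 2) * (∑ q : 𝒳 × 𝒳, (L1 n x q.1 * L1 n x q.2 * (n * Real.binEntropy (p q.1 q.2)) -
        μ q.1 * C q.1 q.2 * μ q.2) - ∑ a, L1 n x a * Real.binEntropy (p a a)) := by
    have h1 := neg_log_graphWeight hμ0 p n x hx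
    rw [sum_comp_eq_L1 hn x (fun a => Real.log (μ a)),
      sum_Edges_of_symm hn x (fun a b => Real.binEntropy (p a b))
        (fun a b => by rw [hpsymm a b])] at h1
    have h2 : ∑ q : 𝒳 × 𝒳, L1 n x q.1 * L1 n x q.2 * (n * Real.binEntropy (p q.1 q.2)) =
        n * ∑ q : 𝒳 × 𝒳, L1 n x q.1 * L1 n x q.2 * Real.binEntropy (p q.1 q.2) := by
      rw [Finset.mul_sum]
      exact Finset.sum_congr rfl fun q _ => by ring
    simp only [sub_mul, Finset.sum_sub_distrib]
    rw [h2, show -(1/(n:ℝ)) * Real.log (graphWeight μ p n x) =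
      (-Real.log (graphWeight μ p n x)) / n by ring, h1]
    field_simp
    ring
  have hcol : |∑ a, (L1 n x a - μ a) * Real.log (μ a)| ≤ (∑ a, |Real.log (μ a)|) * Δ := by
    refine (Finset.abs_sum_le_sum_abs _ _).trans ?_
    rw [Finset.sum_mul]
    refine Finset.sum_le_sum fun a _ => ?_
    rw [abs_mul, mul_comm]
    exact mul_le_mul_of_nonneg_left (hΔle a) (abs_nonneg _)
  have hpair : |∑ q : 𝒳 × 𝒳, (L1 n x q.1 * L1 n x q.2 * (n * Real.binEntropy (p q.1 q.2)) -
        μ q.1 * C q.1 q.2 * μ q.2)| ≤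
      ∑ q : 𝒳 × 𝒳, |(n : ℝ) * Real.binEntropy (p q.1 q.2) - C q.1 q.2| +
        (∑ q : 𝒳 × 𝒳, C q.1 q.2) * (2 * Δ) := by
    refine (Finset.abs_sum_le_sum_abs _ _).trans ?_
    rw [Finset.sum_mul, ← Finset.sum_add_distrib]
    refine Finset.sum_le_sum fun q _ => ?_
    have hL1 := L1_nonneg n x q.1
    have hL2 := L1_nonneg n x q.2
    have hU1 := L1_le_one n x q.1
    have hU2 := L1_le_one n x q.2
    rw [show L1 n x q.1 * L1 n x q.2 * (n * Real.binEntropy (p q.1 q.2)) -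
        μ q.1 * C q.1 q.2 * μ q.2 =
      L1 n x q.1 * L1 n x q.2 * (n * Real.binEntropy (p q.1 q.2) - C q.1 q.2) +
        C q.1 q.2 * (L1 n x q.2 * (L1 n x q.1 - μ q.1) + μ q.1 * (L1 n x q.2 - μ q.2)) by ring]
    refine (abs_add_le _ _).trans (add_le_add ?_ ?_)
    · rw [abs_mul, abs_of_nonneg (mul_nonneg hL1 hL2)]
      exact mul_le_of_le_one_left (abs_nonneg _) (mul_le_one₀ hU1 hL2 hU2)
    · rw [abs_mul, abs_of_nonneg (hC0 _ _)]
      refine mul_le_mul_of_nonneg_left ?_ (hC0 _ _)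
      refine (abs_add_le _ _).trans ?_
      rw [abs_mul, abs_mul, abs_of_nonneg hL2, abs_of_nonneg (hμ0 q.1).le, two_mul]
      exact add_le_add ((mul_le_of_le_one_left (abs_nonneg _) hU2).trans (hΔle _))
        ((mul_le_of_le_one_left (abs_nonneg _) (hμ1 _)).trans (hΔle _))
  have hdiag : |∑ a, L1 n x a * Real.binEntropy (p a a)| ≤ ∑ a, Real.binEntropy (p a a) := by
    rw [abs_of_nonneg (Finset.sum_nonneg fun a _ => mul_nonneg (L1_nonneg n x a) (hent a a))]
    exact Finset.sum_le_sum fun a _ => mul_le_of_le_one_left (hent a a) (L1_le_one n x a)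
  have hfl : |edgeFluct p n x / n| = |edgeFluct p n x| / n := by
    rw [abs_div, abs_of_pos hn']
  have hδ1 : 0 ≤ ∑ q : 𝒳 × 𝒳, |(n : ℝ) * Real.binEntropy (p q.1 q.2) - C q.1 q.2| :=
    Finset.sum_nonneg fun _ _ => abs_nonneg _
  have hδ2 : 0 ≤ ∑ a, Real.binEntropy (p a a) := Finset.sum_nonneg fun a _ => hent a a
  rw [hdec, ← hfl]
  rw [abs_le] at hcol hpair hdiag
  have h3 := le_abs_self (edgeFluct p n x / n)
  have h4 := neg_abs_le (edgeFluct p n x / n)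
  rw [abs_le]
  constructor <;> linarith [hcol.1, hcol.2, hpair.1, hpair.2, hdiag.1, hdiag.2]

/-- Markov's inequality for the second moments. -/
lemma graphPr_info_le {𝒳 : Type} [Fintype 𝒳] [DecidableEq 𝒳] {μ : 𝒳 → ℝ}
    (hμ0 : ∀ a, 0 < μ a) (hμ1 : ∀ a, μ a ≤ 1) (hμs : ∑ a, μ a = 1) {p : 𝒳 → 𝒳 → ℝ}
    (hp0 : ∀ a b, 0 ≤ p a b) (hp1 : ∀ a b, p a b ≤ 1) (hpsymm : ∀ a b, p a b = p b a)
    {C : 𝒳 → 𝒳 → ℝ} (hC0 : ∀ a b, 0 ≤ C a b) {n : ℕ} (hn : 0 < n) {ε : ℝ} (hε : 0 < ε)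
    (hδ : ∑ q : 𝒳 × 𝒳, |(n : ℝ) * Real.binEntropy (p q.1 q.2) - C q.1 q.2| +
        ∑ a, Real.binEntropy (p a a) < ε / 2) :
    graphPr μ p n
      {x | ε ≤ |(-(1/(n:ℝ)) * Real.log (graphWeight μ p n x))
            - (1/2) * ∑ q : 𝒳 × 𝒳, μ q.1 * C q.1 q.2 * μ q.2
            + ∑ i, μ i * Real.log (μ i)|} ≤
      8 / ε ^ 2 * (∑ q : 𝒳 × 𝒳, bernoulliInfoSq (p q.1 q.2)) +
      8 / ε ^ 2 * (∑ a, |Real.log (μ a)| + ∑ q : 𝒳 × 𝒳, C q.1 q.2) ^ 2 *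
        (Fintype.card 𝒳 : ℝ) ^ 2 * (1 / n) := by
  have hn' : (0 : ℝ) < n := by exact_mod_cast hn
  set K := ∑ a, |Real.log (μ a)| + ∑ q : 𝒳 × 𝒳, C q.1 q.2
  have hpt : ∀ x, Set.indicator
      {x | ε ≤ |(-(1/(n:ℝ)) * Real.log (graphWeight μ p n x))
            - (1/2) * ∑ q : 𝒳 × 𝒳, μ q.1 * C q.1 q.2 * μ q.2
            + ∑ i, μ i * Real.log (μ i)|} (graphWeight μ p n) x ≤
      8 / ε ^ 2 / n ^ 2 * (graphWeight μ p n x * edgeFluct p n x ^ 2) +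
      8 / ε ^ 2 * K ^ 2 * Fintype.card 𝒳 *
        ∑ a, graphWeight μ p n x * (L1 n x a - μ a) ^ 2 := by
    intro x
    have hw := graphWeight_nonneg hμ0 hp0 hp1 n x
    have hrhs : 0 ≤ 8 / ε ^ 2 / n ^ 2 * (graphWeight μ p n x * edgeFluct p n x ^ 2) +
      8 / ε ^ 2 * K ^ 2 * Fintype.card 𝒳 *
        ∑ a, graphWeight μ p n x * (L1 n x a - μ a) ^ 2 := by positivity
    by_cases hmem : ε ≤ |(-(1/(n:ℝ)) * Real.log (graphWeight μ p n x))
            - (1/2) * ∑ q : 𝒳 × 𝒳, μ q.1 * C q.1 q.2 * μ q.2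
            + ∑ i, μ i * Real.log (μ i)|
    swap
    · rwa [Set.indicator_of_notMem (by exact hmem)]
    rw [Set.indicator_of_mem (by exact hmem)]
    by_cases hx : graphWeight μ p n x = 0
    · rwa [hx] at hrhs ⊢
    have hb := hmem.trans (abs_info_sub_le hμ0 hμ1 hp0 hp1 hpsymm hC0 hn x hx)
    have hcs : (∑ a, |L1 n x a - μ a|) ^ 2 ≤
        Fintype.card 𝒳 * ∑ a, (L1 n x a - μ a) ^ 2 := by
      have := sq_sum_le_card_mul_sum_sq (s := Finset.univ) (f := fun a => |L1 n x a - μ a|)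
      simpa using this
    set Δ := ∑ a, |L1 n x a - μ a|
    set S := ∑ a, (L1 n x a - μ a) ^ 2 with hS
    have hlow : ε / 2 ≤ |edgeFluct p n x| / n + K * Δ := by linarith
    have hsq : ε ^ 2 / 8 ≤ edgeFluct p n x ^ 2 / n ^ 2 + K ^ 2 * (Fintype.card 𝒳 * S) := by
      have h1 := pow_le_pow_left₀ (by positivity) hlow 2
      have h2 : (|edgeFluct p n x| / n) ^ 2 = edgeFluct p n x ^ 2 / n ^ 2 := by
        rw [div_pow, sq_abs]
      have h3 := mul_le_mul_of_nonneg_left hcs (sq_nonneg K)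
      nlinarith [sq_nonneg (|edgeFluct p n x| / n - K * Δ)]
    rw [← Finset.mul_sum, ← hS]
    have h4 := mul_le_mul_of_nonneg_left hsq
      (mul_nonneg (div_nonneg (by norm_num : (0:ℝ) ≤ 8) (sq_nonneg ε)) hw)
    calc graphWeight μ p n x = 8 / ε ^ 2 * graphWeight μ p n x * (ε ^ 2 / 8) := by
          field_simp
      _ ≤ _ := h4
      _ = _ := by ring
  rw [graphPr]
  refine (Finset.sum_le_sum fun x _ => hpt x).trans ?_
  rw [Finset.sum_add_distrib, ← Finset.mul_sum, ← Finset.mul_sum]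
  refine add_le_add ?_ ?_
  · refine (mul_le_mul_of_nonneg_left
      (sum_graphWeight_mul_edgeFluct_sq_le hμ0 hμs hp0 hp1 n) (by positivity)).trans_eq ?_
    field_simp
  · rw [Finset.sum_comm]
    refine (mul_le_mul_of_nonneg_left (Finset.sum_le_sum fun a _ =>
      sum_graphWeight_mul_L1_sub_sq_le hμ0 hμ1 hμs p hn a) (by positivity)).trans_eq ?_
    simp only [Finset.sum_const, Finset.card_univ, nsmul_eq_mul]
    ring

/-- **AEP for networked structures, critical coding regime** (Theorem 2.3).
If `X` is a coloured random graph with colour law `μ : 𝒳 → (0,1]` and connection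
probabilities `p_n` with `(n log n) pₙ(a,b) → C(a,b)`, then for every `ε > 0`,
`ℙ_n{ |−(1/n) log P_n(X) − ½ Σ_{a,b} μ(a)C(a,b)μ(b) + Σ_a μ(a) log μ(a)| ≥ ε } → 0`. -/
theorem aep_networked_critical
    {𝒳 : Type} [Fintype 𝒳] [DecidableEq 𝒳] [Nonempty 𝒳]
    (μ : 𝒳 → ℝ) (hμ0 : ∀ a, 0 < μ a) (hμ1 : ∀ a, μ a ≤ 1) (hμs : ∑ a, μ a = 1)
    (p : ℕ → 𝒳 → 𝒳 → ℝ) (hp0 : ∀ n a b, 0 ≤ p n a b) (hp1 : ∀ n a b, p n a b ≤ 1)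
    (hpsymm : ∀ n a b, p n a b = p n b a)
    (C : 𝒳 → 𝒳 → ℝ) (hC0 : ∀ a b, 0 ≤ C a b) (hCsymm : ∀ a b, C a b = C b a)
    (hconv : ∀ i j, Filter.Tendsto (fun n : ℕ => ((n : ℝ) * Real.log n) * p n i j)
      Filter.atTop (nhds (C i j))) :
    ∀ ε > 0, Filter.Tendsto (fun n : ℕ => graphPr μ (p n) n
      {x | ε ≤ |(-(1/(n:ℝ)) * Real.log (graphWeight μ (p n) n x))
            - (1/2) * ∑ q : 𝒳 × 𝒳, μ q.1 * C q.1 q.2 * μ q.2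
            + ∑ i, μ i * Real.log (μ i)|})
      Filter.atTop (nhds 0) := by
  intro ε hε
  have hent : Tendsto (fun n : ℕ =>
      ∑ q : 𝒳 × 𝒳, |(n : ℝ) * Real.binEntropy (p n q.1 q.2) - C q.1 q.2| +
        ∑ a, Real.binEntropy (p n a a)) atTop (nhds 0) := by
    have h1 : Tendsto (fun n : ℕ =>
        ∑ q : 𝒳 × 𝒳, |(n : ℝ) * Real.binEntropy (p n q.1 q.2) - C q.1 q.2|) atTop
        (nhds (∑ _q : 𝒳 × 𝒳, 0)) := by
      refine tendsto_finsetSum _ fun q _ => ?_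
      simpa using ((tendsto_mul_binEntropy (fun n => hp0 n q.1 q.2) (fun n => hp1 n q.1 q.2)
        (hconv q.1 q.2)).sub_const (C q.1 q.2)).abs
    have h2 : Tendsto (fun n : ℕ => ∑ a, Real.binEntropy (p n a a)) atTop
        (nhds (∑ _a : 𝒳, 0)) := by
      refine tendsto_finsetSum _ fun a _ => ?_
      have := (Real.binEntropy_continuous.tendsto 0).comp
        (tendsto_zero_of_tendsto_mul_log (hconv a a)).2
      rwa [Real.binEntropy_zero] at this
    simpa using h1.add h2
  have hvar : Tendsto (fun n : ℕ => ∑ q : 𝒳 × 𝒳, bernoulliInfoSq (p n q.1 q.2)) atTop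
      (nhds 0) := by
    have : Tendsto (fun n : ℕ => ∑ q : 𝒳 × 𝒳, bernoulliInfoSq (p n q.1 q.2)) atTop
        (nhds (∑ _q : 𝒳 × 𝒳, 0)) :=
      tendsto_finsetSum _ fun q _ => tendsto_bernoulliInfoSq (fun n => hp0 n q.1 q.2)
        (tendsto_zero_of_tendsto_mul_log (hconv q.1 q.2)).2
    simpa using this
  have hbound := (hvar.const_mul (8 / ε ^ 2)).add
    (tendsto_one_div_atTop_nhds_zero_nat.const_mul
      (8 / ε ^ 2 * (∑ a, |Real.log (μ a)| + ∑ q : 𝒳 × 𝒳, C q.1 q.2) ^ 2 *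
        (Fintype.card 𝒳 : ℝ) ^ 2))
  rw [mul_zero, mul_zero, add_zero] at hbound
  refine tendsto_of_tendsto_of_tendsto_of_le_of_le' tendsto_const_nhds hbound ?_ ?_
  · exact Eventually.of_forall fun n => Finset.sum_nonneg fun x _ =>
      Set.indicator_nonneg (fun x _ => graphWeight_nonneg hμ0 (hp0 n) (hp1 n) n x) x
  · filter_upwards [eventually_gt_atTop 0, hent.eventually_lt_const (half_pos hε)] with n hn hδ
    exact graphPr_info_le hμ0 hμ1 hμs (hp0 n) (hp1 n) (hpsymm n) hC0 hn hε hδ
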